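/- Let f₁(r,p) := Z⁻¹ M(p) ( a(r)·p + ψ(r) ) with a : ℝ³ → ℝ³ and ψ : ℝ³ → ℝ such that all integrals below converge. Then N₀(f₁, f₁)(r,p) = − Z⁻¹ M(p) · ( p · [ ( ∫ g(r,r') ψ(r') Z₁(r,r') dr' ) a(r) ] ) + Z⁻¹ M(p) · ( ∫ g(r,r') Z₂(r,r') a(r') dr' ) · [ a(r) − p ( p·a(r) + ψ(r) ) ]. -/

import Mathlib

open MeasureTheory Real Finset

noncomputable section

abbrev V3 : Type := Fin 3 → ℝ

/-- The (unnormalized) Maxwellian `exp(-|p|²/2)`. -/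
def Mw (p : V3) : ℝ := Real.exp (-(∑ i, p i ^ 2) / 2)

/-- The normalization constant `Z = (2π)^{3/2}`. -/
def Zc : ℝ := (2 * Real.pi) ^ ((3 : ℝ) / 2)

/-- Partial derivative in direction `i`. -/
def pd (i : Fin 3) (f : V3 → ℝ) (x : V3) : ℝ := fderiv ℝ f x (Pi.single i 1)

/-- `(p + ∇_p) f` as a vector field in `p`. -/
def pg (f : V3 → ℝ) (p : V3) : V3 := fun i => p i * f p + pd i f p

/-- Divergence in `p`. -/
def divP (F : V3 → V3) (p : V3) : ℝ := ∑ i, pd i (fun q => F q i) p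

/-- The operator `L₀ f = div_p[(p + ∇_p) f]`. -/
def L0 (f : V3 → V3 → ℝ) (r p : V3) : ℝ := divP (pg (f r)) p

/-- The nonlinear (hydrodynamic-interaction) operator `N₀(f, f̃)`. -/
def N0 (g : V3 → V3 → ℝ) (Z1 Z2 : V3 → V3 → Matrix (Fin 3) (Fin 3) ℝ)
    (f ft : V3 → V3 → ℝ) (r p : V3) : ℝ :=
  divP (fun q i =>
    (∑ j, (∫ r', ∫ p', g r r' * f r' p' * Z1 r r' i j) * pg (ft r) q j)
      + (∫ r', ∫ p', g r r' * ∑ j, Z2 r r' i j * pg (f r') p' j) * ft r q) p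

/-- The transport operator `L₁ f = -p·∇_r f + ∇_r V₁ · ∇_p f`. -/
def L1 (V1 : V3 → ℝ) (f : V3 → V3 → ℝ) (r p : V3) : ℝ :=
  -(∑ i, p i * pd i (fun s => f s p) r) + ∑ i, pd i V1 r * pd i (f r) p

/-- The nonlinear (interaction-potential) operator `N₁(f, f̃)`. -/
def N1 (g : V3 → V3 → ℝ) (V2 : V3 → V3 → ℝ) (f ft : V3 → V3 → ℝ) (r p : V3) : ℝ :=
  ∑ i, (∫ r', ∫ p', f r' p' * g r r' * pd i (fun s => V2 s r') r) * pd i (ft r) p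

/-- Probabilists' Hermite polynomial, evaluated at a real number. -/
def Hp (n : ℕ) (x : ℝ) : ℝ := Polynomial.aeval x (Polynomial.hermite n)

/-- Tensor-product Hermite polynomial `P_{n,a}(p) = ∏ᵢ H_{aᵢ}(pᵢ)`. -/
def Pna (a : Fin 3 → ℕ) (p : V3) : ℝ := ∏ i, Hp (a i) (p i)

/-- Pairwise-additive friction tensor blocks. -/
def Gam {N : ℕ} (Z1 Z2 : V3 → V3 → Matrix (Fin 3) (Fin 3) ℝ) (rs : Fin N → V3) (i j : Fin N) :
    Matrix (Fin 3) (Fin 3) ℝ :=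
  if i = j then 1 + ∑ l ∈ Finset.univ.filter (· ≠ i), Z1 (rs i) (rs l)
  else Z2 (rs i) (rs j)

/-- Insert a value in coordinate `0` of an `N`-tuple. -/
def ins {N : ℕ} [NeZero N] {α : Type*} (x : α) (y : {i : Fin N // i ≠ 0} → α) : Fin N → α :=
  fun i => if h : i = 0 then x else y ⟨i, h⟩

/-- Insert values in coordinates `0` and `1` of an `N`-tuple. -/
def ins2 {N : ℕ} [NeZero N] {α : Type*} (x x' : α) (y : {i : Fin N // i ≠ 0 ∧ i ≠ 1} → α) :
    Fin N → α :=
  fun i => if h0 : i = 0 then x else if h1 : i = 1 then x' else y ⟨i, h0, h1⟩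

/-- Partial derivative `∂/∂(xᵢ)ₖ` for functions on `(ℝ³)ᴺ`. -/
def PDN {N : ℕ} (i : Fin N) (k : Fin 3) (F : (Fin N → V3) → ℝ) (x : Fin N → V3) : ℝ :=
  fderiv ℝ F x (Pi.single i (Pi.single k 1))

theorem Mw_eq_prod (p : V3) : Mw p = ∏ i, Real.exp (-(1 / 2) * p i ^ 2) := by
  rw [Mw, ← Real.exp_sum, ← Finset.mul_sum]
  congr 1
  ring

theorem integrable_Mw : Integrable Mw := by
  have h : Integrable (fun p : V3 => ∏ i, Real.exp (-(1 / 2) * p i ^ 2)) :=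
    Integrable.fintype_prod (f := fun _ x => Real.exp (-(1 / 2) * x ^ 2))
      fun _ => integrable_exp_neg_mul_sq one_half_pos
  exact h.congr (.of_forall fun p => (Mw_eq_prod p).symm)

theorem integral_Mw : ∫ p, Mw p = Zc := by
  simp_rw [Mw_eq_prod]
  rw [integral_fintype_prod_volume_eq_prod (f := fun _ x => Real.exp (-(1 / 2) * x ^ 2))]
  simp only [integral_gaussian, prod_const, card_univ, Fintype.card_fin]
  rw [Zc, Real.sqrt_eq_rpow, ← Real.rpow_natCast, ← Real.rpow_mul (by positivity)]
  congr 1 <;> norm_num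
  ring

theorem Zc_pos : 0 < Zc := by
  unfold Zc
  positivity

theorem integrable_Mw_mul_apply (i : Fin 3) : Integrable (fun p => Mw p * p i) := by
  have h : Integrable (fun p : V3 => ∏ j, (if j = i then p j else 1) *
      Real.exp (-(1 / 2) * p j ^ 2)) := by
    refine Integrable.fintype_prod
      (f := fun j x => (if j = i then x else 1) * Real.exp (-(1 / 2) * x ^ 2)) fun j => ?_
    by_cases hj : j = i
    · simpa [hj] using integrable_mul_exp_neg_mul_sq one_half_pos
    · simpa [hj] using integrable_exp_neg_mul_sq one_half_pos
  refine h.congr (.of_forall fun p => ?_)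
  simp_rw [Finset.prod_mul_distrib, ← Mw_eq_prod]
  simp [mul_comm]

theorem integral_Mw_mul_apply (i : Fin 3) : ∫ p, Mw p * p i = 0 := by
  have h := integral_neg_eq_self (fun p : V3 => Mw p * p i) volume
  simp only [Pi.neg_apply, mul_neg, integral_neg, Mw, neg_sq] at h
  simp only [Mw]
  linarith

theorem integral_Mw_mul_affine (b : V3) (c : ℝ) :
    ∫ p, Zc⁻¹ * Mw p * (∑ i, b i * p i + c) = c := by
  have h : ∀ p, Zc⁻¹ * Mw p * (∑ i, b i * p i + c) =
      (∑ i, Zc⁻¹ * b i * (Mw p * p i)) + Zc⁻¹ * c * Mw p := fun p => by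
    rw [mul_add, Finset.mul_sum]
    congr 1
    · exact Finset.sum_congr rfl fun i _ => by ring
    · ring
  simp_rw [h]
  rw [integral_add
      (integrable_finsetSum _ fun i _ => (integrable_Mw_mul_apply i).const_mul _)
      (integrable_Mw.const_mul _),
    integral_finsetSum _ fun i _ => (integrable_Mw_mul_apply i).const_mul _]
  simp only [integral_const_mul, integral_Mw_mul_apply, integral_Mw]
  have := Zc_pos.ne'
  simp
  field_simp

theorem hasFDerivAt_Mw (p : V3) :
    HasFDerivAt Mw
      (Mw p • -(∑ i, p i • (ContinuousLinearMap.proj i : V3 →L[ℝ] ℝ))) p := by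
  have h : ∀ i : Fin 3, HasFDerivAt (fun q : V3 => q i)
      (ContinuousLinearMap.proj i : V3 →L[ℝ] ℝ) p := fun i => hasFDerivAt_apply i p
  have h2 := (((HasFDerivAt.fun_sum fun i (_ : i ∈ univ) => (h i).pow 2).neg).mul_const
    (2⁻¹ : ℝ)).exp
  convert! h2 using 1
  ext v
  simp [Mw, Fin.sum_univ_three, div_eq_mul_inv]
  ring

theorem hasFDerivAt_affine (b : V3) (c : ℝ) (p : V3) :
    HasFDerivAt (fun q : V3 => ∑ i, b i * q i + c)
      (∑ i, b i • (ContinuousLinearMap.proj i : V3 →L[ℝ] ℝ)) p :=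
  (HasFDerivAt.fun_sum fun i _ => (hasFDerivAt_apply i p).const_mul (b i)).add_const c

theorem differentiable_Mw_mul_affine (b : V3) (c : ℝ) :
    Differentiable ℝ (fun q => Zc⁻¹ * Mw q * (∑ i, b i * q i + c)) := fun p =>
  (((hasFDerivAt_Mw p).const_mul _).fun_mul (hasFDerivAt_affine b c p)).differentiableAt

theorem pd_Mw (i : Fin 3) (p : V3) : pd i Mw p = -(p i * Mw p) := by
  rw [pd, (hasFDerivAt_Mw p).fderiv]
  simp [Pi.single_apply, mul_comm]

theorem pd_Mw_mul_affine (b : V3) (c : ℝ) (i : Fin 3) (p : V3) :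
    pd i (fun q => Zc⁻¹ * Mw q * (∑ j, b j * q j + c)) p =
      Zc⁻¹ * Mw p * (b i - p i * (∑ j, b j * p j + c)) := by
  rw [pd, (((hasFDerivAt_Mw p).const_mul _).fun_mul (hasFDerivAt_affine b c p)).fderiv]
  simp [Pi.single_apply]
  ring

theorem pg_Mw_mul_affine (b : V3) (c : ℝ) (i : Fin 3) (p : V3) :
    pg (fun q => Zc⁻¹ * Mw q * (∑ j, b j * q j + c)) p i = Zc⁻¹ * Mw p * b i := by
  rw [pg, pd_Mw_mul_affine]
  ring

/-- explicit formula for `N₀(f₁, f₁)` with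
`f₁ = Z⁻¹ M (a·p + ψ)`. -/
theorem stmt_14 (g : V3 → V3 → ℝ) (Z1 Z2 : V3 → V3 → Matrix (Fin 3) (Fin 3) ℝ)
    (hZ1 : ∀ x y, (Z1 x y).IsSymm) (hZ2 : ∀ x y, (Z2 x y).IsSymm)
    (a : V3 → V3) (ψ : V3 → ℝ)
    (f1 : V3 → V3 → ℝ)
    (hf1 : ∀ r p, f1 r p = Zc⁻¹ * Mw p * (∑ i, a r i * p i + ψ r))
    (hintZ1 : ∀ (r : V3) (i j : Fin 3),
      Integrable (fun r' => g r r' * ψ r' * Z1 r r' i j))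
    (hintZ2 : ∀ (r : V3) (i : Fin 3),
      Integrable (fun r' => g r r' * ∑ j, Z2 r r' i j * a r' j)) :
    ∀ r p, N0 g Z1 Z2 f1 f1 r p =
      -(Zc⁻¹ * Mw p) *
          (∑ i, p i * ∑ j, (∫ r', g r r' * ψ r' * Z1 r r' i j) * a r j)
        + Zc⁻¹ * Mw p *
          ∑ i, (∫ r', g r r' * ∑ j, Z2 r r' i j * a r' j) *
            (a r i - p i * ((∑ j, p j * a r j) + ψ r)) := by
  intro r p
  have hf : f1 = fun r p => Zc⁻¹ * Mw p * (∑ i, a r i * p i + ψ r) := by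
    ext r p
    exact hf1 r p
  have hC : ∀ i j, (∫ r', ∫ p', g r r' * f1 r' p' * Z1 r r' i j) =
      ∫ r', g r r' * ψ r' * Z1 r r' i j := fun i j => by
    simp only [hf, integral_mul_const, integral_const_mul, integral_Mw_mul_affine]
  have hB : ∀ i, (∫ r', ∫ p', g r r' * ∑ j, Z2 r r' i j * pg (f1 r') p' j) =
      ∫ r', g r r' * ∑ j, Z2 r r' i j * a r' j := fun i => by
    congr 1
    ext r'
    have h : ∀ p', g r r' * ∑ j, Z2 r r' i j * pg (f1 r') p' j =
        (g r r' * ∑ j, Z2 r r' i j * a r' j) * (Zc⁻¹ * Mw p') := fun p' => by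
      simp only [hf, pg_Mw_mul_affine, Finset.mul_sum, Finset.sum_mul]
      exact Finset.sum_congr rfl fun j _ => by ring
    simp_rw [h]
    rw [integral_const_mul, integral_const_mul, integral_Mw, inv_mul_cancel₀ Zc_pos.ne', mul_one]
  simp only [N0, hC, hB]
  simp only [hf, pg_Mw_mul_affine, divP]
  have hpd : ∀ (i : Fin 3) (C : V3) (B : ℝ),
      pd i (fun q => (∑ j, C j * (Zc⁻¹ * Mw q * a r j)) +
        B * (Zc⁻¹ * Mw q * (∑ j, a r j * q j + ψ r))) p =
      -(Zc⁻¹ * Mw p) * (p i * ∑ j, C j * a r j) +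
        Zc⁻¹ * Mw p * (B * (a r i - p i * ((∑ j, p j * a r j) + ψ r))) := fun i C B => by
    have h : ∀ q, (∑ j, C j * (Zc⁻¹ * Mw q * a r j)) =
        (Zc⁻¹ * ∑ j, C j * a r j) * Mw q := fun q => by
      simp only [Finset.mul_sum, Finset.sum_mul]
      exact Finset.sum_congr rfl fun j _ => by ring
    have hM := pd_Mw i p
    have hA := pd_Mw_mul_affine (a r) (ψ r) i p
    simp only [pd] at hM hA ⊢
    simp_rw [h]
    rw [fderiv_fun_add ((hasFDerivAt_Mw p).differentiableAt.const_mul _)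
        ((differentiable_Mw_mul_affine _ _ p).const_mul _),
      fderiv_const_mul (hasFDerivAt_Mw p).differentiableAt,
      fderiv_const_mul (differentiable_Mw_mul_affine _ _ p)]
    simp only [add_apply, smul_apply, smul_eq_mul, hM, hA]
    simp only [mul_comm (p _) (a r _)]
    ring
  rw [Finset.mul_sum, Finset.mul_sum, ← Finset.sum_add_distrib]
  exact Finset.sum_congr rfl fun i _ => hpd i _ _
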